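/- Let d and k be natural numbers with 1 ≤ k < d, and let μ be the uniform probability measure on the unit sphere S^{d-1} ⊂ ℝ^d. Then the pushforward of μ under the map u ↦ Σ_{i=1}^{k} u_i² (the sum of the squares of the first k coordinates) is exactly the Beta distribution with parameters (k/2, (d-k)/2). -/

import Mathlib

open MeasureTheory Metric

/-- The uniform probability measure on the unit sphere `S^{d-1} ⊂ ℝ^d`: the surface
measure on the unit sphere, normalized to have total mass 1. -/
noncomputable def uniformSphere (d : ℕ) :
    Measure (sphere (0 : EuclideanSpace ℝ (Fin d)) 1) :=
  ((volume : Measure (EuclideanSpace ℝ (Fin d))).toSphere Set.univ)⁻¹ •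
    (volume : Measure (EuclideanSpace ℝ (Fin d))).toSphere

/-- The density of the Beta distribution with parameters `(a, b)`:
`x^(a-1) (1-x)^(b-1) / B(a, b)` on `[0, 1]` and `0` elsewhere, where
`B(a, b) = Γ(a) Γ(b) / Γ(a + b)` is the Beta function. -/
noncomputable def betaPDFReal (a b x : ℝ) : ℝ :=
  if x ∈ Set.Icc (0 : ℝ) 1 then
    x ^ (a - 1) * (1 - x) ^ (b - 1) / (Real.Gamma a * Real.Gamma b / Real.Gamma (a + b))
  else 0

/-- The Beta distribution with parameters `(a, b)`. -/
noncomputable def betaMeasure (a b : ℝ) : Measure ℝ :=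
  volume.withDensity fun x => ENNReal.ofReal (betaPDFReal a b x)

open scoped ENNReal

/-- Integration in polar coordinates for nonnegative functions. -/
lemma lintegral_eq_lintegral_toSphere_lintegral_Ioi {E : Type*} [NormedAddCommGroup E]
    [NormedSpace ℝ E] [FiniteDimensional ℝ E] [Nontrivial E] [MeasurableSpace E] [BorelSpace E]
    (μ : Measure E) [μ.IsAddHaarMeasure] {f : E → ℝ≥0∞} (hf : Measurable f) :
    ∫⁻ x, f x ∂μ = ∫⁻ u, ∫⁻ r in Set.Ioi (0 : ℝ),
      ENNReal.ofReal (r ^ (Module.finrank ℝ E - 1)) * f (r • (u : E)) ∂volume ∂μ.toSphere := by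
  have hm : Measurable fun p : sphere (0 : E) 1 × Set.Ioi (0 : ℝ) => f (p.2.1 • p.1.1) :=
    hf.comp (by fun_prop)
  calc ∫⁻ x, f x ∂μ = ∫⁻ x : ({0}ᶜ : Set E), f x ∂(μ.comap (↑)) := by
        rw [lintegral_subtype_comap (measurableSet_singleton _).compl, restrict_compl_singleton]
    _ = ∫⁻ p, f (p.2.1 • p.1.1) ∂(μ.toSphere.prod (.volumeIoiPow (Module.finrank ℝ E - 1))) := by
        rw [← μ.measurePreserving_homeomorphUnitSphereProd.lintegral_comp hm]
        refine lintegral_congr fun x => ?_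
        have := congrArg Subtype.val ((homeomorphUnitSphereProd E).symm_apply_apply x)
        rw [homeomorphUnitSphereProd_symm_apply_coe] at this
        rw [this]
    _ = _ := by
        rw [lintegral_prod _ hm.aemeasurable]
        refine lintegral_congr fun u => ?_
        have hu : Measurable fun r : Set.Ioi (0 : ℝ) => f (r.1 • u.1) :=
          hm.comp measurable_prodMk_left
        dsimp only
        rw [Measure.volumeIoiPow, lintegral_withDensity_eq_lintegral_mul _ (by fun_prop) hu]
        exact lintegral_subtype_comap measurableSet_Ioi
          fun r : ℝ => ENNReal.ofReal (r ^ (Module.finrank ℝ E - 1)) * f (r • (u : E))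

/-- The substitution `s = r ^ 2` on the positive half-line. -/
lemma lintegral_Ioi_pow_mul_comp_sq {n : ℕ} (hn : 1 ≤ n) (f : ℝ → ℝ≥0∞) :
    ∫⁻ s in Set.Ioi (0 : ℝ), ENNReal.ofReal (s ^ ((n : ℝ) / 2 - 1)) * f s =
      2 * ∫⁻ r in Set.Ioi (0 : ℝ), ENNReal.ofReal (r ^ (n - 1)) * f (r ^ 2) := by
  have himg : (fun r : ℝ => r ^ 2) '' Set.Ioi 0 = Set.Ioi 0 := by
    ext s
    constructor
    · rintro ⟨r, hr, rfl⟩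
      exact pow_pos (Set.mem_Ioi.1 hr) 2
    · intro hs
      exact ⟨√s, Real.sqrt_pos.2 hs, Real.sq_sqrt (le_of_lt hs)⟩
  rw [← lintegral_const_mul' _ _ (by simp)]
  conv_lhs => rw [← himg]
  rw [lintegral_image_eq_lintegral_abs_deriv_mul measurableSet_Ioi
    (f' := fun r => 2 * r) (fun r _ => by simpa using (hasDerivAt_pow 2 r).hasDerivWithinAt)
    (fun r hr s hs h => (pow_left_inj₀ (le_of_lt hr) (le_of_lt hs) two_ne_zero).1 h)]
  refine setLIntegral_congr_fun measurableSet_Ioi fun r hr => ?_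
  have hr : 0 < r := hr
  rw [← mul_assoc, ← mul_assoc, ← ENNReal.ofReal_mul (abs_nonneg _)]
  congr 1
  rw [show (2 : ℝ≥0∞) = ENNReal.ofReal 2 by simp, ← ENNReal.ofReal_mul zero_le_two,
    abs_of_pos (by positivity)]
  congr 1
  have hadd (x : ℝ) : r * r ^ x = r ^ (1 + x) := by rw [Real.rpow_add hr, Real.rpow_one]
  rw [← Real.rpow_natCast r 2, ← Real.rpow_mul hr.le, mul_assoc, hadd,
    ← Real.rpow_natCast r (n - 1)]
  congr 2
  push_cast [hn]
  ring

/-- Integrals of functions of `∑ i, y i ^ 2` reduce to one-dimensional integrals. -/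
lemma exists_lintegral_comp_sum_sq_eq (ι : Type*) [Fintype ι] [Nonempty ι] :
    ∃ c : ℝ≥0∞, ∀ f : ℝ → ℝ≥0∞, Measurable f →
      ∫⁻ y : ι → ℝ, f (∑ i, y i ^ 2) =
        c * ∫⁻ s in Set.Ioi (0 : ℝ),
          ENNReal.ofReal (s ^ ((Fintype.card ι : ℝ) / 2 - 1)) * f s := by
  refine ⟨(volume : Measure (EuclideanSpace ℝ ι)).toSphere Set.univ * 2⁻¹, fun f hf => ?_⟩
  have hm : Measurable fun x : EuclideanSpace ℝ ι => f (∑ i, x i ^ 2) := hf.comp (by fun_prop)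
  rw [lintegral_Ioi_pow_mul_comp_sq Fintype.card_pos, mul_assoc, ← mul_assoc 2⁻¹,
    ENNReal.inv_mul_cancel (by simp) (by simp), one_mul]
  calc ∫⁻ y : ι → ℝ, f (∑ i, y i ^ 2)
      = ∫⁻ x : EuclideanSpace ℝ ι, f (∑ i, x i ^ 2) :=
        ((EuclideanSpace.volume_preserving_symm_measurableEquiv_toLp ι).lintegral_comp
          (f := fun y : ι → ℝ => f (∑ i, y i ^ 2)) (hf.comp (by fun_prop))).symm
    _ = _ := by
        rw [lintegral_eq_lintegral_toSphere_lintegral_Ioi _ hm, mul_comm, ← lintegral_const]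
        refine lintegral_congr fun u => ?_
        refine setLIntegral_congr_fun measurableSet_Ioi fun r hr => ?_
        have hu : ∑ i, (u : EuclideanSpace ℝ ι) i ^ 2 = 1 := by
          rw [← EuclideanSpace.real_norm_sq_eq, norm_eq_of_mem_sphere, one_pow]
        simp [mul_pow, ← Finset.mul_sum, hu]

lemma lintegral_comp_mul_left {w : ℝ} (hw : 0 < w) (f : ℝ → ℝ≥0∞) :
    ∫⁻ s, f s = ENNReal.ofReal w * ∫⁻ v, f (w * v) := by
  conv_lhs => rw [← Real.smul_map_volume_mul_left hw.ne']
  rw [lintegral_smul_measure, abs_of_pos hw, smul_eq_mul]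
  exact congrArg _ ((Homeomorph.mulLeft₀ w hw.ne').measurableEmbedding.lintegral_map f)

/-- The change of variables `(s, t) = (w v, w (1 - v))` behind the relation between products of
Gamma densities and Beta densities. -/
lemma lintegral_Ioi_lintegral_Ioi_rpow_eq (a b : ℝ) {f g : ℝ → ℝ≥0∞} (hf : Measurable f)
    (hg : Measurable g) :
    ∫⁻ s in Set.Ioi (0 : ℝ), ENNReal.ofReal (s ^ (a - 1)) *
        ∫⁻ t in Set.Ioi (0 : ℝ), ENNReal.ofReal (t ^ (b - 1)) * (f (s / (s + t)) * g (s + t)) =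
      (∫⁻ w in Set.Ioi (0 : ℝ), ENNReal.ofReal (w ^ (a + b - 1)) * g w) *
        ∫⁻ v in Set.Ioo (0 : ℝ) 1,
          ENNReal.ofReal (v ^ (a - 1) * (1 - v) ^ (b - 1)) * f v := by
  set P : ℝ → ℝ → ℝ≥0∞ := fun c => (Set.Ioi 0).indicator fun s => ENNReal.ofReal (s ^ (c - 1))
    with hP
  have hPm (c : ℝ) : Measurable (P c) := Measurable.indicator (by fun_prop) measurableSet_Ioi
  have hPset (c : ℝ) (h : ℝ → ℝ≥0∞) :
      ∫⁻ s in Set.Ioi (0 : ℝ), ENNReal.ofReal (s ^ (c - 1)) * h s = ∫⁻ s, P c s * h s := by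
    rw [← lintegral_indicator measurableSet_Ioi]
    refine lintegral_congr fun s => ?_
    by_cases hs : s ∈ Set.Ioi (0 : ℝ) <;> simp [hP, hs]
  have hPmul (c w v : ℝ) (hw : 0 < w) : P c (w * v) = ENNReal.ofReal (w ^ (c - 1)) * P c v := by
    by_cases hv : 0 < v
    · simp [hP, hv, hw, Real.mul_rpow hw.le hv.le, ENNReal.ofReal_mul (Real.rpow_nonneg hw.le _)]
    · simp [hP, hv, hw]
  have hP_beta (v : ℝ) : P a v * P b (1 - v) = (Set.Ioo (0 : ℝ) 1).indicator
      (fun v => ENNReal.ofReal (v ^ (a - 1) * (1 - v) ^ (b - 1))) v := by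
    by_cases h0 : 0 < v
    · by_cases h1 : v < 1
      · simp [hP, h0, h1, ENNReal.ofReal_mul (Real.rpow_nonneg h0.le _)]
      · simp [hP, h1]
    · simp [hP, h0]
  simp_rw [hPset]
  calc ∫⁻ s, P a s * ∫⁻ t, P b t * (f (s / (s + t)) * g (s + t))
      = ∫⁻ s, ∫⁻ w, P a s * (P b (w - s) * (f (s / w) * g w)) := by
        refine lintegral_congr fun s => ?_
        rw [← lintegral_const_mul _ (by fun_prop), ← lintegral_sub_right_eq_self _ s]
        simp
    _ = ∫⁻ w, ∫⁻ s, P a s * (P b (w - s) * (f (s / w) * g w)) :=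
        lintegral_lintegral_swap (by fun_prop)
    _ = ∫⁻ w, P (a + b) w * g w * ∫⁻ v, P a v * P b (1 - v) * f v := by
        refine lintegral_congr fun w => ?_
        by_cases hw : 0 < w
        · rw [lintegral_comp_mul_left hw, ← lintegral_const_mul _ (by fun_prop),
            ← lintegral_const_mul _ (by fun_prop)]
          refine lintegral_congr fun v => ?_
          rw [← mul_one_sub, hPmul a w v hw, hPmul b w _ hw, mul_div_cancel_left₀ _ hw.ne']
          have : P (a + b) w = ENNReal.ofReal w * ENNReal.ofReal (w ^ (a - 1)) *
              ENNReal.ofReal (w ^ (b - 1)) := by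
            rw [← ENNReal.ofReal_mul hw.le, ← ENNReal.ofReal_mul (by positivity)]
            refine (Set.indicator_of_mem (Set.mem_Ioi.2 hw) _).trans ?_
            rw [show a + b - 1 = 1 + (a - 1) + (b - 1) by ring, Real.rpow_add hw, Real.rpow_add hw,
              Real.rpow_one]
          rw [this]
          ring
        · have (s : ℝ) : P a s * (P b (w - s) * (f (s / w) * g w)) = 0 := by
            by_cases hs : 0 < s
            · simp [hP, show w ≤ s by linarith]
            · simp [hP, hs]
          rw [lintegral_congr this]
          simp [hP, hw]
    _ = _ := by
        rw [lintegral_mul_const _ (by fun_prop), ← lintegral_indicator measurableSet_Ioo]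
        congr 1
        refine lintegral_congr fun v => ?_
        rw [hP_beta]
        by_cases hv : v ∈ Set.Ioo (0 : ℝ) 1 <;> simp [hv]

lemma isProbabilityMeasure_uniformSphere {d : ℕ} (hd : 0 < d) :
    IsProbabilityMeasure (uniformSphere d) := by
  have : Nonempty (Fin d) := ⟨⟨0, hd⟩⟩
  refine ⟨?_⟩
  rw [uniformSphere, Measure.smul_apply, smul_eq_mul]
  exact ENNReal.inv_mul_cancel (by simp [-Measure.toSphere_apply_univ]) (measure_ne_top _ _)

lemma lintegral_betaMeasure (a b : ℝ) {f : ℝ → ℝ≥0∞} (hf : Measurable f) :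
    ∫⁻ x, f x ∂(betaMeasure a b) =
      ∫⁻ x in Set.Ioo (0 : ℝ) 1, ENNReal.ofReal (betaPDFReal a b x) * f x := by
  have hm : Measurable fun x => ENNReal.ofReal (betaPDFReal a b x) :=
    (Measurable.ite measurableSet_Icc (by fun_prop) measurable_const).ennreal_ofReal
  rw [betaMeasure, lintegral_withDensity_eq_lintegral_mul _ hm hf,
    setLIntegral_congr Ioo_ae_eq_Icc, ← lintegral_indicator measurableSet_Icc]
  refine lintegral_congr fun x => ?_
  by_cases hx : x ∈ Set.Icc (0 : ℝ) 1
  · simp [Set.indicator_of_mem hx]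
  · rw [Set.indicator_of_notMem hx, Pi.mul_apply, betaPDFReal, if_neg hx, ENNReal.ofReal_zero,
      zero_mul]

lemma lintegral_betaMeasure_eq_mul {a b : ℝ} (ha : 0 < a) (hb : 0 < b) {f : ℝ → ℝ≥0∞}
    (hf : Measurable f) :
    ∫⁻ x, f x ∂(betaMeasure a b) = ENNReal.ofReal (ProbabilityTheory.beta a b)⁻¹ *
      ∫⁻ x in Set.Ioo (0 : ℝ) 1, ENNReal.ofReal (x ^ (a - 1) * (1 - x) ^ (b - 1)) * f x := by
  rw [lintegral_betaMeasure a b hf, ← lintegral_const_mul _ (by fun_prop)]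
  refine setLIntegral_congr_fun measurableSet_Ioo fun x hx => ?_
  have := ProbabilityTheory.beta_pos ha hb
  rw [← mul_assoc, ← ENNReal.ofReal_mul (by positivity), betaPDFReal,
    if_pos (Set.Ioo_subset_Icc_self hx), ProbabilityTheory.beta, div_eq_inv_mul]

lemma isProbabilityMeasure_betaMeasure {a b : ℝ} (ha : 0 < a) (hb : 0 < b) :
    IsProbabilityMeasure (betaMeasure a b) := by
  have := ProbabilityTheory.beta_pos ha hb
  refine ⟨?_⟩
  rw [← lintegral_one, lintegral_betaMeasure_eq_mul ha hb measurable_const]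
  refine Eq.trans ?_ (ProbabilityTheory.lintegral_betaPDF_eq_one ha hb)
  rw [ProbabilityTheory.lintegral_betaPDF, ← lintegral_const_mul _ (by fun_prop)]
  refine setLIntegral_congr_fun measurableSet_Ioo fun x _ => ?_
  rw [mul_one, ← ENNReal.ofReal_mul (by positivity), one_div, mul_assoc]

/-- Two probability measures are equal if their integrals are proportional. -/
lemma MeasureTheory.Measure.eq_of_forall_mul_lintegral_eq {α : Type*} [MeasurableSpace α]
    {μ ν : Measure α} [IsProbabilityMeasure μ] [IsProbabilityMeasure ν] {c c' : ℝ≥0∞}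
    (h0 : c ≠ 0) (htop : c ≠ ∞)
    (h : ∀ f : α → ℝ≥0∞, Measurable f → c * ∫⁻ x, f x ∂μ = c' * ∫⁻ x, f x ∂ν) : μ = ν := by
  have hc : c = c' := by simpa using h 1 measurable_const
  subst hc
  ext s hs
  have := h (s.indicator 1) (measurable_one.indicator hs)
  rw [lintegral_indicator_one hs, lintegral_indicator_one hs] at this
  exact (ENNReal.mul_right_inj h0 htop).1 this

/-- Splitting the coordinates into two nonempty groups, a homogeneous function of the two partial
sums of squares integrates on the sphere against a multiple of a Beta weight. -/
lemma exists_mul_lintegral_toSphere_eq {ι : Type*} [Fintype ι] (p : ι → Prop) [DecidablePred p]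
    [Nonempty {i // p i}] [Nonempty {i // ¬ p i}] :
    ∃ c c' : ℝ≥0∞, c ≠ 0 ∧ c ≠ ∞ ∧ ∀ f : ℝ → ℝ≥0∞, Measurable f →
      c * ∫⁻ u, f (∑ i : {i // p i}, (u : EuclideanSpace ℝ ι) i ^ 2)
          ∂(volume : Measure (EuclideanSpace ℝ ι)).toSphere =
        c' * ∫⁻ v in Set.Ioo (0 : ℝ) 1,
          ENNReal.ofReal (v ^ ((Fintype.card {i // p i} : ℝ) / 2 - 1) *
            (1 - v) ^ ((Fintype.card {i // ¬ p i} : ℝ) / 2 - 1)) * f v := by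
  have : Nonempty ι := ⟨(Classical.arbitrary {i // p i}).1⟩
  obtain ⟨c₁, h₁⟩ := exists_lintegral_comp_sum_sq_eq {i // p i}
  obtain ⟨c₂, h₂⟩ := exists_lintegral_comp_sum_sq_eq {i // ¬ p i}
  set n := Module.finrank ℝ (EuclideanSpace ℝ ι)
  set a := (Fintype.card {i // p i} : ℝ) / 2
  set b := (Fintype.card {i // ¬ p i} : ℝ) / 2
  set g : ℝ → ℝ≥0∞ := (Set.Iio 1).indicator 1 with hg
  have hgm : Measurable g := measurable_one.indicator measurableSet_Iio
  have hc : ∫⁻ r in Set.Ioi (0 : ℝ), ENNReal.ofReal (r ^ (n - 1)) * g (r ^ 2) =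
      ENNReal.ofReal (1 / ((n - 1 : ℕ) + 1)) := by
    have := Measure.volumeIoiPow_apply_Iio (n - 1) ⟨1, Set.mem_Ioi.2 one_pos⟩
    rw [one_pow] at this
    rw [← this, Measure.volumeIoiPow, withDensity_apply _ measurableSet_Iio,
      ← lintegral_indicator measurableSet_Iio, ← lintegral_subtype_comap measurableSet_Ioi]
    refine lintegral_congr fun r => ?_
    have hr : 0 < r.1 := r.2
    have hiff : r.1 ^ 2 < 1 ↔ r < ⟨1, Set.mem_Ioi.2 one_pos⟩ := by
      rw [← Subtype.coe_lt_coe, sq_lt_one_iff₀ hr.le]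
    by_cases h : r.1 ^ 2 < 1
    · simp [hg, h, hiff.1 h]
    · simp [hg, h, mt hiff.2 h]
  refine ⟨∫⁻ r in Set.Ioi (0 : ℝ), ENNReal.ofReal (r ^ (n - 1)) * g (r ^ 2),
    c₁ * c₂ * ∫⁻ w in Set.Ioi (0 : ℝ), ENNReal.ofReal (w ^ (a + b - 1)) * g w, ?_, ?_, ?_⟩
  · rw [hc, Ne, ENNReal.ofReal_eq_zero, not_le]
    positivity
  · rw [hc]
    exact ENNReal.ofReal_ne_top
  intro f hf
  set F : (ι → ℝ) → ℝ≥0∞ := fun x =>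
    f ((∑ i : {i // p i}, x i ^ 2) /
        ((∑ i : {i // p i}, x i ^ 2) + ∑ i : {i // ¬ p i}, x i ^ 2)) *
      g ((∑ i : {i // p i}, x i ^ 2) + ∑ i : {i // ¬ p i}, x i ^ 2) with hF
  have hFm : Measurable F := by fun_prop
  calc _ = ∫⁻ x : EuclideanSpace ℝ ι, F x := by
        rw [lintegral_eq_lintegral_toSphere_lintegral_Ioi (E := EuclideanSpace ℝ ι) _
          (f := fun x => F x) (by fun_prop), ← lintegral_const_mul]
        · refine lintegral_congr fun u => ?_
          rw [← lintegral_mul_const _ (by fun_prop)]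
          refine setLIntegral_congr_fun measurableSet_Ioi fun r hr => ?_
          have hr : 0 < r := hr
          have hu : (∑ i : {i // p i}, (u : EuclideanSpace ℝ ι) i ^ 2) +
              ∑ i : {i // ¬ p i}, (u : EuclideanSpace ℝ ι) i ^ 2 = 1 := by
            rw [Fintype.sum_subtype_add_sum_subtype p fun i => (u : EuclideanSpace ℝ ι) i ^ 2,
              ← EuclideanSpace.real_norm_sq_eq, norm_eq_of_mem_sphere, one_pow]
          simp only [hF, PiLp.smul_apply, smul_eq_mul, mul_pow, ← Finset.mul_sum, ← mul_add, hu,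
            mul_one]
          rw [mul_div_cancel_left₀ _ (by positivity)]
          ring
        · fun_prop
    _ = ∫⁻ x : ι → ℝ, F x :=
        (EuclideanSpace.volume_preserving_symm_measurableEquiv_toLp ι).lintegral_comp hFm
    _ = ∫⁻ y : {i // p i} → ℝ, ∫⁻ z : {i // ¬ p i} → ℝ,
          f ((∑ i, y i ^ 2) / ((∑ i, y i ^ 2) + ∑ i, z i ^ 2)) *
            g ((∑ i, y i ^ 2) + ∑ i, z i ^ 2) := by
        have hm : Measurable fun q : ({i // p i} → ℝ) × ({i // ¬ p i} → ℝ) =>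
            f ((∑ i, q.1 i ^ 2) / ((∑ i, q.1 i ^ 2) + ∑ i, q.2 i ^ 2)) *
              g ((∑ i, q.1 i ^ 2) + ∑ i, q.2 i ^ 2) := by fun_prop
        rw [← lintegral_prod _ hm.aemeasurable]
        exact (volume_preserving_piEquivPiSubtypeProd (fun _ : ι => ℝ) p).lintegral_comp hm
    _ = _ := by
        simp_rw [fun s : ℝ => h₂ (fun t => f (s / (s + t)) * g (s + t)) (by fun_prop)]
        rw [h₁ (fun s => c₂ * ∫⁻ t in Set.Ioi (0 : ℝ),
            ENNReal.ofReal (t ^ (b - 1)) * (f (s / (s + t)) * g (s + t))) (by fun_prop)]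
        simp_rw [mul_left_comm _ c₂]
        rw [lintegral_const_mul _ (by fun_prop), lintegral_Ioi_lintegral_Ioi_rpow_eq a b hf hgm]
        ring

theorem pushforward_sum_sq_first_coords_uniformSphere_eq_beta
    (d k : ℕ) (hk : 1 ≤ k) (hkd : k < d) :
    (uniformSphere d).map
      (fun u : sphere (0 : EuclideanSpace ℝ (Fin d)) 1 =>
        ∑ i : Fin k, ((u : EuclideanSpace ℝ (Fin d)) (Fin.castLE hkd.le i)) ^ 2) =
      betaMeasure ((k : ℝ) / 2) (((d : ℝ) - (k : ℝ)) / 2) := by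
  have hkd' : (k : ℝ) < d := by exact_mod_cast hkd
  have ha : 0 < (k : ℝ) / 2 := by positivity
  have hb : 0 < ((d : ℝ) - k) / 2 := by linarith
  have hm : Measurable fun u : sphere (0 : EuclideanSpace ℝ (Fin d)) 1 =>
      ∑ i : Fin k, ((u : EuclideanSpace ℝ (Fin d)) (Fin.castLE hkd.le i)) ^ 2 := by fun_prop
  have := isProbabilityMeasure_uniformSphere (k.zero_le.trans_lt hkd)
  have := isProbabilityMeasure_betaMeasure ha hb
  have := Measure.isProbabilityMeasure_map (μ := uniformSphere d) hm.aemeasurable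
  let p : Fin d → Prop := fun i => (i : ℕ) < k
  have : Nonempty {i // p i} := ⟨⟨⟨0, by omega⟩, hk⟩⟩
  have : Nonempty {i // ¬ p i} := ⟨⟨⟨k, hkd⟩, lt_irrefl k⟩⟩
  let e : Fin k ≃ {i // p i} :=
    { toFun := fun i => ⟨Fin.castLE hkd.le i, i.2⟩
      invFun := fun i => ⟨i.1, i.2⟩
      left_inv := fun _ => rfl
      right_inv := fun _ => rfl }
  have hcard : Fintype.card {i // p i} = k := by simpa using (Fintype.card_congr e).symm
  have hcard' : (Fintype.card {i // ¬ p i} : ℝ) = d - k := by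
    rw [Fintype.card_subtype_compl, hcard, Fintype.card_fin, Nat.cast_sub hkd.le]
  obtain ⟨c, c', h0, htop, h⟩ := exists_mul_lintegral_toSphere_eq p
  rw [hcard, hcard'] at h
  set S := (volume : Measure (EuclideanSpace ℝ (Fin d))).toSphere
  have hβ := ProbabilityTheory.beta_pos ha hb
  set B := ProbabilityTheory.beta ((k : ℝ) / 2) (((d : ℝ) - k) / 2)
  refine Measure.eq_of_forall_mul_lintegral_eq (c' := (S Set.univ)⁻¹ * c' * ENNReal.ofReal B)
    h0 htop fun f hf => ?_
  have hB : ENNReal.ofReal B * ENNReal.ofReal B⁻¹ = 1 := by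
    rw [← ENNReal.ofReal_mul hβ.le, mul_inv_cancel₀ hβ.ne', ENNReal.ofReal_one]
  rw [lintegral_map hf hm, uniformSphere, lintegral_smul_measure,
    lintegral_betaMeasure_eq_mul ha hb hf, ← mul_assoc _ (ENNReal.ofReal B⁻¹),
    mul_assoc _ (ENNReal.ofReal B), hB, mul_one, mul_assoc _ c', ← h f hf, smul_eq_mul,
    mul_left_comm]
  congr! 5 with u
  exact Fintype.sum_equiv e _ _ fun _ => rfl
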